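/- Let F be a free group, and for w ∈ F let |w| denote the length of the reduced word representing w. Let g ≥ 1 and m ≥ 1, let C_1, …, C_{m-1}, C be nontrivial cyclically reduced elements of F, and set s = |C_1| + … + |C_{m-1}| + |C|. Suppose the standard orientable quadratic equation ( ∏_{i=1}^{g} [x_i,y_i] ) · ( ∏_{j=1}^{m-1} z_j⁻¹ C_j z_j ) · C = 1 has a solution in F. Then there exist elements w_1,…,w_{m-1} ∈ F with |w_j| ≤ 2s for all j, and elements a_1,b_1,…,a_g,b_g ∈ F with |a_i| < 2s and |b_i| < 2s for all i, such that ( ∏_{j=1}^{m-1} w_j⁻¹ C_j w_j ) · C = [a_1,b_1]·[a_2,b_2]·…·[a_g,b_g]. -/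

import Mathlib

/-- An element of a free group is cyclically reduced if, in its reduced word,
the first letter is not the inverse of the last letter. -/
def CyclicallyReduced {α : Type*} [DecidableEq α] (w : FreeGroup α) : Prop :=
  ∀ x ∈ w.toWord.head?, ∀ y ∈ w.toWord.getLast?, x.1 = y.1 → x.2 = y.2

namespace QE

section linear
variable {ι : Type*}

/-- value of a signed letter under a functional -/
def lv (φ : ι → ℚ) (u : ι × Bool) : ℚ := if u.2 then φ u.1 else - φ u.1

/-- value of a word under a functional -/
def ev (φ : ι → ℚ) (U : List (ι × Bool)) : ℚ := (U.map (lv φ)).sum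

/-- the alternating form of a word -/
def om (φ ψ : ι → ℚ) : List (ι × Bool) → ℚ
  | [] => 0
  | u :: U => lv φ u * ev ψ U - lv ψ u * ev φ U + om φ ψ U

/-- the inverse letter -/
def iv (u : ι × Bool) : ι × Bool := (u.1, !u.2)

@[simp] lemma iv_iv (u : ι × Bool) : iv (iv u) = u := by simp [iv]
@[simp] lemma iv_fst (u : ι × Bool) : (iv u).1 = u.1 := rfl
lemma iv_ne (u : ι × Bool) : iv u ≠ u := by
  rcases u with ⟨a, b⟩; cases b <;> simp [iv]

lemma eq_or_eq_iv {u w : ι × Bool} (h : w.1 = u.1) : w = u ∨ w = iv u := by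
  rcases u with ⟨a, b⟩; rcases w with ⟨c, d⟩
  simp only at h; subst h
  cases b <;> cases d <;> simp [iv]

@[simp] lemma lv_iv (φ : ι → ℚ) (u) : lv φ (iv u) = - lv φ u := by
  rcases u with ⟨a, b⟩; cases b <;> simp [iv, lv]

@[simp] lemma ev_nil (φ : ι → ℚ) : ev φ [] = 0 := rfl
@[simp] lemma ev_cons (φ : ι → ℚ) (u U) : ev φ (u :: U) = lv φ u + ev φ U := by simp [ev]
@[simp] lemma ev_append (φ : ι → ℚ) (U W) : ev φ (U ++ W) = ev φ U + ev φ W := by simp [ev]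
@[simp] lemma om_nil (φ ψ : ι → ℚ) : om φ ψ [] = 0 := rfl
@[simp] lemma om_cons (φ ψ : ι → ℚ) (u U) :
  om φ ψ (u :: U) = lv φ u * ev ψ U - lv ψ u * ev φ U + om φ ψ U := rfl
@[simp] lemma om_append (φ ψ : ι → ℚ) (U W) :
    om φ ψ (U ++ W) = om φ ψ U + om φ ψ W + (ev φ U * ev ψ W - ev ψ U * ev φ W) := by
  induction U with
  | nil => simp
  | cons u U ih => simp [ih]; ring

/-- formal inverse of a word -/
def rv (U : List (ι × Bool)) : List (ι × Bool) := (U.map iv).reverse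

@[simp] lemma rv_nil : rv ([] : List (ι × Bool)) = [] := rfl
@[simp] lemma rv_cons (u : ι × Bool) (U) : rv (u :: U) = rv U ++ [iv u] := by simp [rv]
@[simp] lemma rv_append (U W : List (ι × Bool)) : rv (U ++ W) = rv W ++ rv U := by simp [rv]
@[simp] lemma ev_rv (φ : ι → ℚ) (U) : ev φ (rv U) = - ev φ U := by
  induction U with
  | nil => simp
  | cons u U ih => simp [ih]
@[simp] lemma om_rv (φ ψ : ι → ℚ) (U) : om φ ψ (rv U) = - om φ ψ U := by
  induction U with
  | nil => simp
  | cons u U ih => simp [ih]; ring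
lemma mem_rv {U : List (ι × Bool)} {u} : u ∈ rv U ↔ iv u ∈ U := by
  simp only [rv, List.mem_reverse, List.mem_map]
  constructor
  · rintro ⟨w, hw, rfl⟩; simpa
  · intro h; exact ⟨_, h, iv_iv u⟩

lemma ev_congr {φ φ' : ι → ℚ} {U : List (ι × Bool)} (h : ∀ u ∈ U, φ u.1 = φ' u.1) :
    ev φ U = ev φ' U := by
  induction U with
  | nil => rfl
  | cons u U ih =>
    simp only [List.mem_cons, forall_eq_or_imp] at h
    simp [ih h.2, lv, h.1]

lemma om_congr {φ φ' ψ ψ' : ι → ℚ} {U : List (ι × Bool)} (h : ∀ u ∈ U, φ u.1 = φ' u.1)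
    (h' : ∀ u ∈ U, ψ u.1 = ψ' u.1) :
    om φ ψ U = om φ' ψ' U := by
  induction U with
  | nil => rfl
  | cons u U ih =>
    simp only [List.mem_cons, forall_eq_or_imp] at h h'
    simp [ih h.2 h'.2, lv, h.1, h'.1, ev_congr h.2, ev_congr h'.2]

/-- orientable quadratic list of letters -/
def Quad (T : List (ι × Bool)) : Prop := T.Nodup ∧ ∀ u ∈ T, iv u ∈ T

lemma Quad.perm {T T' : List (ι × Bool)} (h : Quad T) (p : T.Perm T') : Quad T' :=
  ⟨p.nodup_iff.1 h.1, fun u hu => p.mem_iff.1 (h.2 u (p.mem_iff.2 hu))⟩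

lemma Quad.ev {T : List (ι × Bool)} (h : Quad T) (φ : ι → ℚ) : ev φ T = 0 := by
  classical
  rw [QE.ev, ← List.sum_toFinset _ h.1]
  refine Finset.sum_involution (fun u _ => iv u) ?_ ?_ ?_ ?_
  · intro u _; simp
  · intro u _ _; exact iv_ne u
  · intro u hu; simpa using h.2 u (by simpa using hu)
  · intro u _; simp

lemma Quad.rest_ne {u : ι × Bool} {R} (h : Quad (u :: iv u :: R)) : ∀ w ∈ R, w.1 ≠ u.1 := by
  intro w hw e
  have := h.1
  simp only [List.nodup_cons, List.mem_cons, not_or] at this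
  rcases eq_or_eq_iv e with rfl | rfl
  · exact this.1.2 hw
  · exact this.2.1 hw

lemma Quad.rest {u : ι × Bool} {R} (h : Quad (u :: iv u :: R)) : Quad R := by
  refine ⟨?_, ?_⟩
  · have := h.1
    simp only [List.nodup_cons] at this
    exact this.2.2
  · intro w hw
    have h1 := h.rest_ne w hw
    have := h.2 w (by simp [hw])
    simp only [List.mem_cons] at this
    rcases this with e | e | e
    · exact absurd (by rw [← e]; rfl) h1
    · exact absurd (by rw [← iv_fst w, e]; rfl) h1
    · exact e

lemma Quad.append {T T' : List (ι × Bool)} (h : Quad T) (h' : Quad T')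
    (d : ∀ u ∈ T, u ∉ T') : Quad (T ++ T') := by
  refine ⟨List.Nodup.append h.1 h'.1 (fun u hu hu' => d u hu hu'), ?_⟩
  intro u hu
  rcases List.mem_append.1 hu with hu | hu
  · exact List.mem_append_left _ (h.2 u hu)
  · exact List.mem_append_right _ (h'.2 u hu)

lemma quad_rv {T : List (ι × Bool)} (h : (T.map Prod.fst).Nodup) : Quad (T ++ rv T) := by
  have key : ∀ u ∈ T, iv u ∉ T := by
    intro u hu hu'
    have := List.inj_on_of_nodup_map h hu hu' rfl
    exact iv_ne u this.symm
  refine ⟨List.Nodup.append (List.Nodup.of_map _ h) ?_ ?_, ?_⟩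
  · rw [rv, List.nodup_reverse]
    exact (List.Nodup.of_map _ h).map (fun a b e => by simpa using congrArg iv e)
  · intro u hu hu'
    rw [mem_rv] at hu'
    exact key u hu hu'
  · intro u hu
    rcases List.mem_append.1 hu with hu | hu
    · exact List.mem_append_right _ (mem_rv.2 (by simpa))
    · exact List.mem_append_left _ (mem_rv.1 hu)

variable {K : Type*}

/-- all letters of a system -/
def tot (cs : List (K × List (ι × Bool))) (U : List (ι × Bool)) : List (ι × Bool) :=
  U ++ cs.flatMap Prod.snd

/-- functionals vanishing on the coefficients -/
def Ann (cs : List (K × List (ι × Bool))) (φ : ι → ℚ) : Prop := ∀ c ∈ cs, ev φ c.2 = 0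

/-- form of a system -/
def Om (cs : List (K × List (ι × Bool))) (U : List (ι × Bool)) (φ ψ : ι → ℚ) : ℚ :=
  om φ ψ U + (cs.map fun c => om φ ψ c.2).sum

/-- hyperbolic families -/
def Hyp {V : Type*} (B : V → V → ℚ) (k : ℕ) (p q : Fin k → V) : Prop :=
  (∀ i j, B (p i) (q j) = if i = j then 1 else 0) ∧ (∀ i j, B (p i) (p j) = 0) ∧
    (∀ i j, B (q i) (q j) = 0)

/-- genus at most `n` -/
def Good (n : ℕ) (cs : List (K × List (ι × Bool))) (U : List (ι × Bool)) : Prop :=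
  Quad (tot cs U) ∧ ∀ k (p q : Fin k → (ι → ℚ)), (∀ i, Ann cs (p i)) → (∀ i, Ann cs (q i)) →
    Hyp (Om cs U) k p q → k ≤ n

/-- genus at most `n`, explicit version -/
def WGood (n : ℕ) (cs : List (K × List (ι × Bool))) (U : List (ι × Bool)) : Prop :=
  Quad (tot cs U) ∧ ∃ a b : Fin n → (ι → ℚ) →ₗ[ℚ] ℚ, ∀ φ ψ, Ann cs φ → Ann cs ψ →
    Om cs U φ ψ = ∑ i, (a i φ * b i ψ - b i φ * a i ψ)

lemma WGood.good {n : ℕ} {cs : List (K × List (ι × Bool))} {U : List (ι × Bool)}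
    (h : WGood n cs U) : Good n cs U := by
  obtain ⟨hq, a, b, hab⟩ := h
  refine ⟨hq, fun k p q hp hq ⟨h1, h2, h3⟩ => ?_⟩
  let B : (ι → ℚ) →ₗ[ℚ] (ι → ℚ) →ₗ[ℚ] ℚ :=
    LinearMap.mk₂ ℚ (fun φ ψ => ∑ i, (a i φ * b i ψ - b i φ * a i ψ))
      (by intros; simp only [map_add, ← Finset.sum_add_distrib]
          refine Finset.sum_congr rfl fun _ _ => ?_; ring)
      (by intros; simp only [map_smul, smul_eq_mul, Finset.mul_sum]
          refine Finset.sum_congr rfl fun _ _ => ?_; ring)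
      (by intros; simp only [map_add, ← Finset.sum_add_distrib]
          refine Finset.sum_congr rfl fun _ _ => ?_; ring)
      (by intros; simp only [map_smul, smul_eq_mul, Finset.mul_sum]
          refine Finset.sum_congr rfl fun _ _ => ?_; ring)
  have hB : ∀ φ ψ, B φ ψ = ∑ i, (a i φ * b i ψ - b i φ * a i ψ) := fun _ _ => rfl
  let θ : (ι → ℚ) →ₗ[ℚ] (Fin n ⊕ Fin n → ℚ) :=
    LinearMap.pi (Sum.elim a b)
  have hθ : ∀ r, θ r = 0 → ∀ ψ, B r ψ = 0 := by
    intro r hr ψ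
    rw [hB]
    refine Finset.sum_eq_zero fun i _ => ?_
    have e1 : a i r = 0 := congrFun hr (Sum.inl i)
    have e2 : b i r = 0 := congrFun hr (Sum.inr i)
    rw [e1, e2]; ring
  have hli : LinearIndependent ℚ (fun x : Fin k ⊕ Fin k => θ (Sum.elim p q x)) := by
    rw [Fintype.linearIndependent_iff]
    intro g hg
    have e0 : θ (∑ x, g x • Sum.elim p q x) = 0 := by simpa using hg
    have e1 := hθ _ e0
    have B1 : ∀ i j, B (p i) (q j) = if i = j then 1 else 0 := fun i j => by
      rw [hB, ← hab _ _ (hp i) (hq j), h1]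
    have B2 : ∀ i j, B (p i) (p j) = 0 := fun i j => by
      rw [hB, ← hab _ _ (hp i) (hp j), h2]
    have B3 : ∀ i j, B (q i) (q j) = 0 := fun i j => by
      rw [hB, ← hab _ _ (hq i) (hq j), h3]
    have B4 : ∀ i j, B (q i) (p j) = if i = j then -1 else 0 := fun i j => by
      have : B (q i) (p j) = - B (p j) (q i) := by
        rw [hB, hB, ← Finset.sum_neg_distrib]
        refine Finset.sum_congr rfl fun _ _ => ?_; ring
      rw [this, B1]; by_cases e : i = j <;> simp [e, eq_comm]
    rintro (i | i)
    · simpa [B1, B3] using e1 (q i)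
    · simpa [B2, B4] using e1 (p i)
  have := hli.fintype_card_le_finrank
  simp at this
  omega

lemma Good.transfer {K' : Type*} {n : ℕ} {cs : List (K × List (ι × Bool))} {U : List (ι × Bool)}
    {cs' : List (K' × List (ι × Bool))} {U' : List (ι × Bool)}
    (h : Good n cs U) (hq : Quad (tot cs' U')) (L : (ι → ℚ) → (ι → ℚ))
    (hL : ∀ φ, Ann cs' φ → Ann cs (L φ))
    (hO : ∀ φ ψ, Ann cs' φ → Ann cs' ψ → Om cs U (L φ) (L ψ) = Om cs' U' φ ψ) :
    Good n cs' U' := by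
  refine ⟨hq, fun k p q hp hq ⟨h1, h2, h3⟩ => ?_⟩
  refine h.2 k (fun i => L (p i)) (fun i => L (q i)) (fun i => hL _ (hp i))
    (fun i => hL _ (hq i)) ⟨?_, ?_, ?_⟩
  · intro i j; rw [hO _ _ (hp i) (hq j), h1]
  · intro i j; rw [hO _ _ (hp i) (hp j), h2]
  · intro i j; rw [hO _ _ (hq i) (hq j), h3]

lemma mem_cs_sub {cs : List (K × List (ι × Bool))} {c} (hc : c ∈ cs) {u} (hu : u ∈ c.2) :
    u ∈ cs.flatMap Prod.snd := List.mem_flatMap.2 ⟨c, hc, hu⟩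

lemma sum_om_congr {cs : List (K × List (ι × Bool))} {φ φ' ψ ψ' : ι → ℚ}
    (h : ∀ u ∈ cs.flatMap Prod.snd, φ u.1 = φ' u.1)
    (h' : ∀ u ∈ cs.flatMap Prod.snd, ψ u.1 = ψ' u.1) :
    (cs.map fun c => om φ ψ c.2).sum = (cs.map fun c => om φ' ψ' c.2).sum := by
  congr 1
  refine List.map_congr_left fun c hc => ?_
  exact om_congr (fun u hu => h u (mem_cs_sub hc hu)) (fun u hu => h' u (mem_cs_sub hc hu))

/-- gluing a coefficient along a common letter -/
lemma Good.attach {n : ℕ} {cs₁ cs₂ : List (K × List (ι × Bool))} {k : K}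
    {A B P Q : List (ι × Bool)} {u : ι × Bool}
    (h : Good n (cs₁ ++ (k, P ++ iv u :: Q) :: cs₂) (A ++ u :: B)) :
    Good n (cs₁ ++ cs₂) (A ++ (Q ++ P) ++ B) := by
  classical
  have hp : (tot (cs₁ ++ (k, P ++ iv u :: Q) :: cs₂) (A ++ u :: B)).Perm
      (u :: iv u :: tot (cs₁ ++ cs₂) (A ++ (Q ++ P) ++ B)) := by
    rw [List.perm_iff_count]
    intro w
    simp only [tot, List.flatMap_append, List.flatMap_cons, List.count_append, List.count_cons]
    omega
  have hq := h.1.perm hp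
  have hne := hq.rest_ne
  have hA : ∀ w ∈ A, w.1 ≠ u.1 := fun w hw => hne w (by simp [tot, hw])
  have hB : ∀ w ∈ B, w.1 ≠ u.1 := fun w hw => hne w (by simp [tot, hw])
  have hP : ∀ w ∈ P, w.1 ≠ u.1 := fun w hw => hne w (by simp [tot, hw])
  have hQ : ∀ w ∈ Q, w.1 ≠ u.1 := fun w hw => hne w (by simp [tot, hw])
  have h1 : ∀ w ∈ cs₁.flatMap Prod.snd, w.1 ≠ u.1 := fun w hw =>
    hne w (by rw [tot, List.flatMap_append]; simp only [List.mem_append]; tauto)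
  have h2 : ∀ w ∈ cs₂.flatMap Prod.snd, w.1 ≠ u.1 := fun w hw =>
    hne w (by rw [tot, List.flatMap_append]; simp only [List.mem_append]; tauto)
  let L : (ι → ℚ) → (ι → ℚ) := fun φ =>
    Function.update φ u.1 (if u.2 then ev φ (Q ++ P) else - ev φ (Q ++ P))
  have hLne : ∀ (X : List (ι × Bool)), (∀ w ∈ X, w.1 ≠ u.1) → ∀ φ, ∀ w ∈ X, L φ w.1 = φ w.1 :=
    fun X hX φ w hw => Function.update_of_ne (hX w hw) _ _
  have hLu : ∀ φ, lv (L φ) u = ev φ Q + ev φ P := by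
    intro φ
    simp only [lv, L, Function.update_self]
    split_ifs <;> simp
  have evL : ∀ (X : List (ι × Bool)), (∀ w ∈ X, w.1 ≠ u.1) → ∀ φ, ev (L φ) X = ev φ X :=
    fun X hX φ => ev_congr (hLne X hX φ)
  have omL : ∀ (X : List (ι × Bool)), (∀ w ∈ X, w.1 ≠ u.1) → ∀ φ ψ,
    om (L φ) (L ψ) X = om φ ψ X := fun X hX φ ψ => om_congr (hLne X hX φ) (hLne X hX ψ)
  refine h.transfer hq.rest L ?_ ?_
  · intro φ hφ c hc
    simp only [List.mem_append, List.mem_cons] at hc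
    rcases hc with hc | rfl | hc
    · rw [evL _ (fun w hw => h1 w (mem_cs_sub hc hw))]; exact hφ c (by simp [hc])
    · simp only [ev_append, ev_cons, lv_iv, hLu, evL P hP, evL Q hQ]; ring
    · rw [evL _ (fun w hw => h2 w (mem_cs_sub hc hw))]; exact hφ c (by simp [hc])
  · intro φ ψ hφ hψ
    simp only [Om, List.map_append, List.map_cons, List.sum_append, List.sum_cons, om_append,
      om_cons, ev_append, ev_cons, lv_iv, hLu, evL P hP, evL Q hQ, evL A hA, evL B hB,
      omL P hP, omL Q hQ, omL A hA, omL B hB]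
    rw [sum_om_congr (hLne _ h1 φ) (hLne _ h1 ψ), sum_om_congr (hLne _ h2 φ) (hLne _ h2 ψ)]
    ring

/-- adding a coefficient not linked to the main word -/
lemma Good.adjoin {n : ℕ} {cs : List (K × List (ι × Bool))} {k : K}
    {c U : List (ι × Bool)} (h : Good n ((k, c) :: cs) U)
    (hU : ∀ u ∈ U, ∀ d ∈ (k, c) :: cs, iv u ∉ d.2) : Good n cs (U ++ c) := by
  have hq : Quad U := by
    refine ⟨(List.nodup_append.1 h.1.1).1, fun u hu => ?_⟩
    rcases List.mem_append.1 (h.1.2 u (List.mem_append_left _ hu)) with h1 | h1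
    · exact h1
    · obtain ⟨d, hd, hd'⟩ := List.mem_flatMap.1 h1
      exact absurd hd' (hU u hu d hd)
  have hs : ∀ φ : ι → ℚ, Ann cs φ → ev φ (cs.flatMap Prod.snd) = 0 := by
    intro φ hφ
    clear hU h
    induction cs with
    | nil => rfl
    | cons d cs ih =>
      rw [List.flatMap_cons, ev_append, hφ d (by simp), ih (fun e he => hφ e (by simp [he]))]
      simp
  have hc : ∀ φ : ι → ℚ, Ann cs φ → ev φ c = 0 := by
    intro φ hφ
    have := h.1.ev φ
    rw [tot, List.flatMap_cons, ev_append, ev_append, hq.ev, hs φ hφ] at this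
    simpa using this
  refine h.transfer (by simpa [tot] using h.1) id ?_ ?_
  · intro φ hφ d hd
    rcases List.mem_cons.1 hd with rfl | hd
    · exact hc φ hφ
    · exact hφ d hd
  · intro φ ψ hφ hψ
    simp only [Om, id, List.map_cons, List.sum_cons, om_append, hq.ev]
    ring

/-- cancelling an adjacent pair -/
lemma Good.cancel {n : ℕ} {cs : List (K × List (ι × Bool))}
    {A B : List (ι × Bool)} {u : ι × Bool}
    (h : Good n cs (A ++ u :: iv u :: B)) : Good n cs (A ++ B) := by
  classical
  have hp : (tot cs (A ++ u :: iv u :: B)).Perm (u :: iv u :: tot cs (A ++ B)) := by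
    rw [List.perm_iff_count]
    intro w
    simp only [tot, List.count_append, List.count_cons]
    omega
  refine h.transfer (h.1.perm hp).rest id (fun _ h => h) ?_
  intro φ ψ _ _
  simp only [Om, id, om_append, om_cons, ev_cons, lv_iv]
  ring

/-- removing a handle -/
lemma Good.handle {n : ℕ} {A B D E G : List (ι × Bool)} {x y : ι × Bool}
    (h : Good n ([] : List (K × List (ι × Bool)))
      (A ++ x :: (B ++ y :: (D ++ iv x :: (E ++ iv y :: G))))) :
    ∃ n', n = n' + 1 ∧ Good n' ([] : List (K × List (ι × Bool))) (A ++ (E ++ (D ++ (B ++ G)))) := by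
  classical
  have hp : (tot ([] : List (K × List (ι × Bool)))
      (A ++ x :: (B ++ y :: (D ++ iv x :: (E ++ iv y :: G))))).Perm
      (x :: iv x :: y :: iv y :: tot ([] : List (K × List (ι × Bool)))
        (A ++ (E ++ (D ++ (B ++ G))))) := by
    rw [List.perm_iff_count]
    intro w
    simp only [tot, List.count_append, List.count_cons]
    omega
  have hq := h.1.perm hp
  have hx := hq.rest_ne
  have hq2 := hq.rest
  have hy := hq2.rest_ne
  have hq3 := hq2.rest
  have hxy : y.1 ≠ x.1 := hx y (by simp)
  set R := A ++ (E ++ (D ++ (B ++ G))) with hR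
  have hx' : ∀ w ∈ R, w.1 ≠ x.1 := fun w hw => hx w (by simp [tot, hw])
  have hy' : ∀ w ∈ R, w.1 ≠ y.1 := fun w hw => hy w (by simp [tot, hw])
  let M : (ι → ℚ) → ℚ → ℚ → (ι → ℚ) := fun φ s t =>
    Function.update (Function.update φ x.1 (if x.2 then s else -s)) y.1 (if y.2 then t else -t)
  have Mx : ∀ φ s t, lv (M φ s t) x = s := by
    intro φ s t
    simp only [lv, M, Function.update_of_ne hxy.symm, Function.update_self]
    split_ifs <;> simp
  have My : ∀ φ s t, lv (M φ s t) y = t := by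
    intro φ s t
    simp only [lv, M, Function.update_self]
    split_ifs <;> simp
  have Mne : ∀ X : List (ι × Bool), (∀ w ∈ X, w ∈ R) → ∀ φ s t, ∀ w ∈ X,
      M φ s t w.1 = φ w.1 := by
    intro X hX φ s t w hw
    simp only [M]
    rw [Function.update_of_ne (hy' w (hX w hw)), Function.update_of_ne (hx' w (hX w hw))]
  have evM : ∀ X : List (ι × Bool), (∀ w ∈ X, w ∈ R) → ∀ φ s t, ev (M φ s t) X = ev φ X :=
    fun X hX φ s t => ev_congr (Mne X hX φ s t)
  have omM : ∀ X : List (ι × Bool), (∀ w ∈ X, w ∈ R) → ∀ φ s t φ' s' t',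
      om (M φ s t) (M φ' s' t') X = om φ φ' X :=
    fun X hX φ s t φ' s' t' => om_congr (Mne X hX φ s t) (Mne X hX φ' s' t')
  have hA : ∀ w ∈ A, w ∈ R := fun w hw => by simp [hR, hw]
  have hB : ∀ w ∈ B, w ∈ R := fun w hw => by simp [hR, hw]
  have hD : ∀ w ∈ D, w ∈ R := fun w hw => by simp [hR, hw]
  have hE : ∀ w ∈ E, w ∈ R := fun w hw => by simp [hR, hw]
  have hG : ∀ w ∈ G, w ∈ R := fun w hw => by simp [hR, hw]
  set O := Om ([] : List (K × List (ι × Bool)))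
    (A ++ x :: (B ++ y :: (D ++ iv x :: (E ++ iv y :: G)))) with hO
  have form : ∀ φ s t φ' s' t', O (M φ s t) (M φ' s' t') =
      om φ φ' A + om φ φ' B + om φ φ' D + om φ φ' E + om φ φ' G
      + (ev φ A * (s' + ev φ' B + t' + ev φ' D - s' + ev φ' E - t' + ev φ' G)
        - ev φ' A * (s + ev φ B + t + ev φ D - s + ev φ E - t + ev φ G))
      + (s * (ev φ' B + t' + ev φ' D - s' + ev φ' E - t' + ev φ' G)
        - s' * (ev φ B + t + ev φ D - s + ev φ E - t + ev φ G))
      + (ev φ B * (t' + ev φ' D - s' + ev φ' E - t' + ev φ' G)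
        - ev φ' B * (t + ev φ D - s + ev φ E - t + ev φ G))
      + (t * (ev φ' D - s' + ev φ' E - t' + ev φ' G)
        - t' * (ev φ D - s + ev φ E - t + ev φ G))
      + (ev φ D * (- s' + ev φ' E - t' + ev φ' G)
        - ev φ' D * (- s + ev φ E - t + ev φ G))
      + (-s * (ev φ' E - t' + ev φ' G) + s' * (ev φ E - t + ev φ G))
      + (ev φ E * (- t' + ev φ' G) - ev φ' E * (- t + ev φ G))
      + (-t * ev φ' G + t' * ev φ G) := by
    intro φ s t φ' s' t'
    simp only [hO, Om, List.map_nil, List.sum_nil, om_append, om_cons, ev_append, ev_cons, lv_iv,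
      Mx, My, evM A hA, evM B hB, evM D hD, evM E hE, evM G hG,
      omM A hA, omM B hB, omM D hD, omM E hE, omM G hG]
    ring
  have ev0 : ∀ X : List (ι × Bool), ev (0 : ι → ℚ) X = 0 := by
    intro X
    induction X with
    | nil => rfl
    | cons u X ih => simp [ih, lv]
  have om0 : ∀ φ (X : List (ι × Bool)), om (0 : ι → ℚ) φ X = 0 := by
    intro φ X
    induction X with
    | nil => rfl
    | cons u X ih => simp [ih, lv, ev0]
  have om0' : ∀ φ (X : List (ι × Bool)), om φ (0 : ι → ℚ) X = 0 := by
    intro φ X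
    induction X with
    | nil => rfl
    | cons u X ih => simp [ih, lv, ev0]
  let L : (ι → ℚ) → (ι → ℚ) := fun φ => M φ (ev φ D + ev φ E) (-(ev φ B + ev φ D))
  let p₀ : ι → ℚ := M 0 (1 / 2) 0
  let q₀ : ι → ℚ := M 0 0 1
  have key : ∀ k (p q : Fin k → (ι → ℚ)), Hyp (Om ([] : List (K × List (ι × Bool))) R) k p q →
      k + 1 ≤ n := by
    intro k p q ⟨h1, h2, h3⟩
    have hL : ∀ φ ψ, O (L φ) (L ψ) = Om ([] : List (K × List (ι × Bool))) R φ ψ := by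
      intro φ ψ
      simp only [L, form]
      simp only [hR, Om, List.map_nil, List.sum_nil, om_append, ev_append]
      ring
    have a1 : ∀ φ, O p₀ (L φ) = 0 := by
      intro φ; simp only [p₀, L, form, ev0, om0]; ring
    have a2 : ∀ φ, O (L φ) p₀ = 0 := by
      intro φ; simp only [p₀, L, form, ev0, om0']; ring
    have a3 : ∀ φ, O q₀ (L φ) = 0 := by
      intro φ; simp only [q₀, L, form, ev0, om0]; ring
    have a4 : ∀ φ, O (L φ) q₀ = 0 := by
      intro φ; simp only [q₀, L, form, ev0, om0']; ring
    have a5 : O p₀ q₀ = 1 := by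
      simp only [p₀, q₀, form, ev0, om0']; ring
    have a6 : O p₀ p₀ = 0 := by
      simp only [p₀, form, ev0, om0']; ring
    have a7 : O q₀ q₀ = 0 := by
      simp only [q₀, form, ev0, om0']; ring
    refine h.2 (k + 1) (Fin.cons p₀ fun i => L (p i)) (Fin.cons q₀ fun i => L (q i))
      (fun i c hc => by simp at hc) (fun i c hc => by simp at hc) ⟨?_, ?_, ?_⟩
    · intro i j
      refine Fin.cases ?_ (fun i => ?_) i <;> refine Fin.cases ?_ (fun j => ?_) j
      · simpa using a5
      · simpa [Fin.succ_ne_zero, eq_comm] using a1 (q j)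
      · simpa [Fin.succ_ne_zero] using a4 (p i)
      · simp only [Fin.cons_succ, Fin.succ_inj]
        rw [← h1]; exact hL _ _
    · intro i j
      refine Fin.cases ?_ (fun i => ?_) i <;> refine Fin.cases ?_ (fun j => ?_) j
      · simpa using a6
      · simpa using a1 (p j)
      · simpa using a2 (p i)
      · simp only [Fin.cons_succ]
        rw [← h2 i j]; exact hL _ _
    · intro i j
      refine Fin.cases ?_ (fun i => ?_) i <;> refine Fin.cases ?_ (fun j => ?_) j
      · simpa using a7
      · simpa using a3 (q j)
      · simpa using a4 (q i)
      · simp only [Fin.cons_succ]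
        rw [← h3 i j]; exact hL _ _
  have h0 : 0 + 1 ≤ n := key 0 Fin.elim0 Fin.elim0
    ⟨fun i => i.elim0, fun i => i.elim0, fun i => i.elim0⟩
  obtain ⟨n', rfl⟩ : ∃ n', n = n' + 1 := ⟨n - 1, by omega⟩
  refine ⟨n', rfl, hq3, fun k p q _ _ hh => ?_⟩
  have := key k p q hh
  omega

/-- a nonempty quadratic word has an adjacent pair or a crossing pair -/
lemma Quad.exists_pair {U : List (ι × Bool)} (h : Quad U) (hne : U ≠ []) :
    (∃ A B u, U = A ++ u :: iv u :: B) ∨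
    ∃ A B D E G x y, U = A ++ x :: (B ++ y :: (D ++ iv x :: (E ++ iv y :: G))) := by
  classical
  have hex : ∃ l, ∃ A B G u, U = A ++ u :: (B ++ iv u :: G) ∧ B.length = l := by
    obtain ⟨u, U', rfl⟩ := List.exists_cons_of_ne_nil hne
    have h1 : iv u ∈ U' := by
      rcases List.mem_cons.1 (h.2 u (by simp)) with e | e
      · exact absurd e (iv_ne u)
      · exact e
    obtain ⟨B, G, rfl⟩ := List.append_of_mem h1
    exact ⟨_, [], B, G, u, rfl, rfl⟩
  obtain ⟨A, B, G, u, hU, hl⟩ := Nat.find_spec hex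
  have hmin := fun l (hl : l < Nat.find hex) => Nat.find_min hex hl
  rw [← hl] at hmin
  rcases B with _ | ⟨y, B⟩
  · left; exact ⟨A, G, u, by simpa using hU⟩
  · right
    have hy : iv y ∈ U := h.2 y (by simp [hU])
    have hnd := h.1
    rw [hU] at hy hnd
    simp only [List.mem_append, List.mem_cons] at hy
    have hyu : y.1 ≠ u.1 := by
      intro e
      rcases eq_or_eq_iv e with rfl | rfl <;>
      · simp [List.nodup_append, List.nodup_cons] at hnd
    rcases hy with hy | hy | (hy | hy) | hy | hy
    · obtain ⟨A1, A2, rfl⟩ := List.append_of_mem hy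
      refine ⟨A1, A2, [], B, G, iv y, u, ?_⟩
      rw [hU]; simp
    · exact absurd (by rw [← hy]; rfl) hyu
    · exact absurd hy (iv_ne y)
    · obtain ⟨B1, B2, rfl⟩ := List.append_of_mem hy
      exact absurd ⟨A ++ [u], B1, B2 ++ iv u :: G, y, by rw [hU]; simp, rfl⟩
        (hmin B1.length (by simp))
    · exact absurd (by rw [← iv_fst y, hy]; rfl) hyu
    · obtain ⟨G1, G2, rfl⟩ := List.append_of_mem hy
      exact ⟨A, [], B, G1, G2, u, y, hU⟩


/-- action of a renaming on letters -/
def rn (σ : ι → ι) (w : ι × Bool) : ι × Bool := (σ w.1, w.2)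

lemma ev_rn (σ : ι → ι) (φ : ι → ℚ) (X) : ev φ (X.map (rn σ)) = ev (φ ∘ σ) X := by
  induction X with
  | nil => rfl
  | cons u X ih => simp [ih, lv, rn]

lemma om_rn (σ : ι → ι) (φ ψ : ι → ℚ) (X) :
    om φ ψ (X.map (rn σ)) = om (φ ∘ σ) (ψ ∘ σ) X := by
  induction X with
  | nil => rfl
  | cons u X ih =>
    have h : ∀ φ : ι → ℚ, lv φ (rn σ u) = lv (φ ∘ σ) u := fun φ => rfl
    simp [ih, ev_rn, h]

lemma Quad.merge [DecidableEq ι] {u v : ι × Bool} {R} (h : Quad (u :: v :: R))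
    (h2 : v.2 = !u.2) (h1 : v.1 ≠ u.1) :
    Quad (R.map (rn fun e => if e = v.1 then u.1 else e)) := by
  obtain ⟨hn, hc⟩ := h
  simp only [List.nodup_cons, List.mem_cons, not_or] at hn
  obtain ⟨⟨huv, huR⟩, hvR, hR⟩ := hn
  have hvu : iv v ≠ u := fun e => h1 (by rw [← e]; rfl)
  have hvi : iv v ∈ R := by
    have := hc v (by simp)
    simp only [List.mem_cons] at this
    rcases this with e | e | e
    · exact absurd e hvu
    · exact absurd e (iv_ne v)
    · exact e
  have hui : iv u ∈ R := by
    have := hc u (by simp)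
    simp only [List.mem_cons] at this
    rcases this with e | e | e
    · exact absurd e (iv_ne u)
    · exact absurd (by rw [← e]; rfl) h1
    · exact e
  have onlyv : ∀ w ∈ R, w.1 = v.1 → w = iv v := by
    intro w hw e
    rcases eq_or_eq_iv e with rfl | e
    · exact absurd hw hvR
    · exact e
  have onlyu : ∀ w ∈ R, w.1 = u.1 → w = iv u := by
    intro w hw e
    rcases eq_or_eq_iv e with rfl | e
    · exact absurd hw huR
    · exact e
  have hrv : ∀ b, rn (fun e => if e = v.1 then u.1 else e) (v.1, b) = (u.1, b) := by
    intro b; simp [rn]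
  have hrne : ∀ w : ι × Bool, w.1 ≠ v.1 → rn (fun e => if e = v.1 then u.1 else e) w = w := by
    intro w hw; simp [rn, hw]
  have hv' : iv v = (v.1, u.2) := by simp [iv, h2]
  have hv'' : rn (fun e => if e = v.1 then u.1 else e) (iv v) = u := by rw [hv', hrv]
  refine ⟨hR.map_on ?_, ?_⟩
  · intro w hw w' hw' e
    by_cases e1 : w.1 = v.1 <;> by_cases e2 : w'.1 = v.1
    · rw [onlyv w hw e1, onlyv w' hw' e2]
    · rw [onlyv w hw e1, hv'', hrne _ e2] at e
      exact absurd (e ▸ hw') huR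
    · rw [onlyv w' hw' e2, hv'', hrne _ e1] at e
      exact absurd (e ▸ hw) huR
    · rwa [hrne _ e1, hrne _ e2] at e
  · intro w hw
    obtain ⟨w, hwR, rfl⟩ := List.mem_map.1 hw
    clear hw
    have hw := hwR
    by_cases e1 : w.1 = v.1
    · rw [onlyv w hw e1, hv'']
      exact List.mem_map.2 ⟨iv u, hui, hrne _ (by simpa using h1.symm)⟩
    · rw [hrne _ e1]
      by_cases e2 : w.1 = u.1
      · rw [onlyu w hw e2, iv_iv]
        exact List.mem_map.2 ⟨iv v, hvi, hv''⟩
      · refine List.mem_map.2 ⟨iv w, ?_, hrne _ (by simpa using e1)⟩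
        have := hc w (by simp [hw])
        simp only [List.mem_cons] at this
        rcases this with e | e | e
        · exact absurd (by rw [← e]; rfl) e2
        · exact absurd (by rw [← e]; rfl) e1
        · exact e

/-- identification of two symbols followed by a cancellation -/
lemma Good.merge [DecidableEq ι] {n : ℕ} {cs : List (K × List (ι × Bool))}
    {A B : List (ι × Bool)} {u v : ι × Bool}
    (h : Good n cs (A ++ u :: v :: B)) (h2 : v.2 = !u.2) (h1 : v.1 ≠ u.1) :
    Good n (cs.map fun c => (c.1, c.2.map (rn fun e => if e = v.1 then u.1 else e)))
      ((A ++ B).map (rn fun e => if e = v.1 then u.1 else e)) := by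
  set σ : ι → ι := fun e => if e = v.1 then u.1 else e with hσ
  have hp : (tot cs (A ++ u :: v :: B)).Perm (u :: v :: tot cs (A ++ B)) := by
    rw [List.perm_iff_count]
    intro w
    simp only [tot, List.count_append, List.count_cons]
    omega
  have hq := (h.1.perm hp).merge h2 h1
  have hl : ∀ φ : ι → ℚ, lv (φ ∘ σ) v = - lv (φ ∘ σ) u := by
    intro φ
    have : lv (φ ∘ σ) v = lv (φ ∘ σ) (iv u) := by
      simp [lv, hσ, h2, iv]
    rw [this, lv_iv]
  refine h.transfer ?_ (fun φ => φ ∘ σ) ?_ ?_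
  · convert hq using 1
    simp only [tot, List.map_append, List.flatMap_map, List.map_flatMap, hσ]
  · intro φ hφ c hc
    rw [← ev_rn]
    exact hφ _ (List.mem_map.2 ⟨c, hc, rfl⟩)
  · intro φ ψ _ _
    simp only [Om, List.map_map, Function.comp_def, om_rn]
    simp only [om_append, om_cons, ev_cons]
    have h3 := hl φ
    have h4 := hl ψ
    simp only [Function.comp_def] at h3 h4
    rw [h3, h4]
    ring

end linear

section words
variable {α : Type*} {K : Type*}

/-- label of a formal letter -/
def lab (u : (α × ℕ) × Bool) : α × Bool := (u.1.1, u.2)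

/-- value of a formal word -/
def val (U : List ((α × ℕ) × Bool)) : FreeGroup α := FreeGroup.mk (U.map lab)

@[simp] lemma val_nil : val ([] : List ((α × ℕ) × Bool)) = 1 := rfl
lemma val_append (U W : List ((α × ℕ) × Bool)) : val (U ++ W) = val U * val W := by
  simp [val, FreeGroup.mul_mk]
lemma val_cons (u) (U : List ((α × ℕ) × Bool)) : val (u :: U) = val [u] * val U :=
  val_append [u] U
lemma val_iv (u : (α × ℕ) × Bool) : val [iv u] = (val [u])⁻¹ := by
  simp [val, FreeGroup.inv_mk, FreeGroup.invRev, iv, lab]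
lemma val_rv (U : List ((α × ℕ) × Bool)) : val (rv U) = (val U)⁻¹ := by
  induction U with
  | nil => simp
  | cons u U ih => rw [rv_cons, val_append, ih, val_iv, val_cons u U, mul_inv_rev]

lemma norm_val_le [DecidableEq α] (U : List ((α × ℕ) × Bool)) : (val U).norm ≤ U.length := by
  have := FreeGroup.norm_mk_le (L₁ := U.map lab)
  simpa [val] using this

/-- labels of the coefficients -/
def labs (cs : List (K × List ((α × ℕ) × Bool))) : List (K × List (α × Bool)) :=
  cs.map fun c => (c.1, c.2.map lab)

lemma Good.step {n : ℕ} {cs : List (K × List ((α × ℕ) × Bool))} {U : List ((α × ℕ) × Bool)}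
    {W : List (α × Bool)} (h : Good n cs U) (hr : FreeGroup.Red.Step (U.map lab) W) :
    ∃ cs' U', Good n cs' U' ∧ U'.map lab = W ∧ labs cs' = labs cs := by
  classical
  generalize hV : U.map lab = V at hr
  obtain ⟨⟩ := hr
  rename_i A B x b
  obtain ⟨A', U', rfl, rfl, hV1⟩ := List.map_eq_append_iff.1 hV
  obtain ⟨u, U', rfl, hu, hV2⟩ := List.map_eq_cons_iff.1 hV1
  obtain ⟨v, B', rfl, hv, rfl⟩ := List.map_eq_cons_iff.1 hV2
  rcases u with ⟨⟨x1, i⟩, b1⟩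
  rcases v with ⟨⟨x2, j⟩, b2⟩
  simp only [lab, Prod.mk.injEq] at hu hv
  obtain ⟨rfl, rfl⟩ := hu
  obtain ⟨rfl, rfl⟩ := hv
  by_cases e : j = i
  · subst e
    exact ⟨cs, A' ++ B', Good.cancel h, by simp, rfl⟩
  · have hl : ∀ w : (α × ℕ) × Bool,
        lab (rn (fun e => if e = (x2, j) then (x2, i) else e) w) = lab w := by
      intro w
      simp only [lab, rn]
      split_ifs with hw
      · rw [hw]
      · rfl
    refine ⟨_, _, Good.merge h rfl (by simpa using e), ?_, ?_⟩
    · simp [Function.comp_def, hl]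
    · simp [labs, Function.comp_def, hl]

lemma Good.red {V W : List (α × Bool)} (hr : FreeGroup.Red V W) {n : ℕ} :
    ∀ (cs : List (K × List ((α × ℕ) × Bool))) (U : List ((α × ℕ) × Bool)),
    U.map lab = V → Good n cs U →
    ∃ cs' U', Good n cs' U' ∧ U'.map lab = W ∧ labs cs' = labs cs := by
  induction hr using Relation.ReflTransGen.head_induction_on with
  | refl => intro cs U hU h; exact ⟨cs, U, h, hU, rfl⟩
  | head h1 h2 ih =>
    intro cs U hU h
    subst hU
    obtain ⟨cs1, U1, g1, e1, e2⟩ := h.step h1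
    obtain ⟨cs2, U2, g2, e3, e4⟩ := ih cs1 U1 e1 g1
    exact ⟨cs2, U2, g2, e3, e4.trans e2⟩

lemma exists_fresh (a : List (α × Bool)) : ∀ N : ℕ, ∃ a' : List ((α × ℕ) × Bool),
    a'.map lab = a ∧ (a'.map Prod.fst).Nodup ∧ ∀ u ∈ a', N ≤ u.1.2 := by
  induction a with
  | nil => intro N; exact ⟨[], rfl, by simp, by simp⟩
  | cons u a ih =>
    intro N
    obtain ⟨a', h1, h2, h3⟩ := ih (N + 1)
    refine ⟨((u.1, N), u.2) :: a', by simp [h1, lab], ?_, ?_⟩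
    · simp only [List.map_cons, List.nodup_cons, h2, and_true, List.mem_map, not_exists, not_and]
      intro w hw e
      have := h3 w hw
      rw [e] at this
      simp at this
    · intro w hw
      rcases List.mem_cons.1 hw with rfl | hw
      · simp
      · have := h3 w hw; omega

lemma exists_bound (T : List ((α × ℕ) × Bool)) : ∃ N, ∀ u ∈ T, u.1.2 < N := by
  induction T with
  | nil => exact ⟨0, by simp⟩
  | cons u T ih =>
    obtain ⟨N, hN⟩ := ih
    refine ⟨max N (u.1.2 + 1), fun w hw => ?_⟩
    rcases List.mem_cons.1 hw with rfl | hw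
    · simp
    · have := hN w hw; simp [this]

/-- two fresh words -/
lemma exists_fresh₂ (a b : List (α × Bool)) {T : List ((α × ℕ) × Bool)} (hT : Quad T) :
    ∃ a' b' : List ((α × ℕ) × Bool), a'.map lab = a ∧ b'.map lab = b ∧
      Quad (((a' ++ b') ++ rv (a' ++ b')) ++ T) := by
  obtain ⟨N, hN⟩ := exists_bound T
  obtain ⟨c, h1, h2, h3⟩ := exists_fresh (a ++ b) N
  obtain ⟨a', b', rfl, ha, hb⟩ := List.map_eq_append_iff.1 h1
  refine ⟨a', b', ha, hb, (quad_rv h2).append hT ?_⟩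
  intro u hu hu'
  have := hN u hu'
  rcases List.mem_append.1 hu with hu | hu
  · have := h3 u hu; omega
  · have := h3 _ (mem_rv.1 hu); simp at this; omega

lemma WGood.comm [DecidableEq α] {n : ℕ} {cs : List (K × List ((α × ℕ) × Bool))}
    {U : List ((α × ℕ) × Bool)}
    (h : WGood n cs U) (x y : FreeGroup α) (hU : cs = []) :
    ∃ U', WGood (n + 1) cs U' ∧ val U' = x⁻¹ * y⁻¹ * x * y * val U := by
  obtain ⟨hq, a, b, hab⟩ := h
  obtain ⟨x', y', hx, hy, hQ⟩ := exists_fresh₂ x.toWord y.toWord hq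
  have hx' : val x' = x := by rw [val, hx, FreeGroup.mk_toWord]
  have hy' : val y' = y := by rw [val, hy, FreeGroup.mk_toWord]
  subst hU
  have hU0 : ∀ φ, ev φ U = 0 := fun φ => by simpa [tot] using hq.ev φ
  have evl : ∀ (X : List ((α × ℕ) × Bool)), ∃ l : ((α × ℕ) → ℚ) →ₗ[ℚ] ℚ, ∀ φ, l φ = ev φ X := by
    intro X
    induction X with
    | nil => exact ⟨0, fun _ => rfl⟩
    | cons u X ih =>
      obtain ⟨l, hl⟩ := ih
      refine ⟨(if u.2 then 1 else -1 : ℚ) • LinearMap.proj u.1 + l, fun φ => ?_⟩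
      simp only [LinearMap.add_apply, LinearMap.smul_apply, LinearMap.proj_apply, hl, ev_cons, lv]
      split_ifs <;> simp
  obtain ⟨lx, hlx⟩ := evl x'
  obtain ⟨ly, hly⟩ := evl y'
  refine ⟨rv x' ++ rv y' ++ x' ++ y' ++ U, ⟨hQ.perm ?_, Fin.cons ((2 : ℚ) • lx) a,
    Fin.cons ly b, ?_⟩, ?_⟩
  · rw [List.perm_iff_count]
    intro w
    simp only [tot, rv_append, List.count_append]
    omega
  · intro φ ψ h1 h2
    rw [Fin.sum_univ_succ]
    simp only [Fin.cons_zero, Fin.cons_succ]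
    rw [← hab φ ψ h1 h2]
    simp only [Om, om_append, ev_append, ev_rv, om_rv, hU0, LinearMap.smul_apply, hlx, hly,
      smul_eq_mul]
    ring
  · simp only [val_append, val_rv, hx', hy']

lemma WGood.coef [DecidableEq α] {n : ℕ} {cs : List (K × List ((α × ℕ) × Bool))}
    {U : List ((α × ℕ) × Bool)}
    (h : WGood n cs U) (k : K) (c z : FreeGroup α) :
    ∃ c' U', WGood n ((k, c') :: cs) U' ∧ c'.map lab = c.toWord ∧
      val U' = z⁻¹ * c⁻¹ * z * val U := by
  obtain ⟨hq, a, b, hab⟩ := h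
  obtain ⟨z', c', hz, hc, hQ⟩ := exists_fresh₂ z.toWord c.toWord hq
  have hz' : val z' = z := by rw [val, hz, FreeGroup.mk_toWord]
  have hc' : val c' = c := by rw [val, hc, FreeGroup.mk_toWord]
  refine ⟨c', rv z' ++ rv c' ++ z' ++ U, ⟨hQ.perm ?_, a, b, ?_⟩, hc, ?_⟩
  · rw [List.perm_iff_count]
    intro w
    simp only [tot, rv_append, List.count_append, List.flatMap_cons]
    omega
  · intro φ ψ h1 h2
    have e1 : ev φ c' = 0 := h1 (k, c') (by simp)
    have e2 : ev ψ c' = 0 := h2 (k, c') (by simp)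
    rw [← hab φ ψ (fun d hd => h1 d (by simp [hd])) (fun d hd => h2 d (by simp [hd]))]
    simp only [Om, om_append, ev_append, ev_rv, om_rv, e1, e2, List.map_cons, List.sum_cons]
    ring
  · simp only [val_append, val_rv, hc', hz']

lemma start_comm [DecidableEq α] (l : List (FreeGroup α × FreeGroup α)) :
    ∃ U, WGood l.length ([] : List (K × List ((α × ℕ) × Bool))) U ∧
      val U = (l.map fun p => p.1⁻¹ * p.2⁻¹ * p.1 * p.2).prod := by
  induction l with
  | nil =>
    refine ⟨[], ⟨⟨by simp [tot], by simp [tot]⟩, Fin.elim0, Fin.elim0, ?_⟩, by simp⟩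
    intro φ ψ _ _; simp [Om]
  | cons p l ih =>
    obtain ⟨U, h1, h2⟩ := ih
    obtain ⟨U', h3, h4⟩ := h1.comm p.1 p.2 rfl
    exact ⟨U', h3, by rw [h4, h2]; simp⟩

lemma start_coef [DecidableEq α] (Cw z : K → FreeGroup α) {n : ℕ} {U₀ : List ((α × ℕ) × Bool)}
    (h : WGood n ([] : List (K × List ((α × ℕ) × Bool))) U₀) (l : List K) :
    ∃ cs U, WGood n cs U ∧ labs cs = l.map (fun k => (k, (Cw k).toWord)) ∧
      val U = (l.map fun k => (z k)⁻¹ * (Cw k)⁻¹ * z k).prod * val U₀ := by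
  induction l with
  | nil => exact ⟨[], U₀, h, rfl, by simp⟩
  | cons k l ih =>
    obtain ⟨cs, U, h1, h2, h3⟩ := ih
    obtain ⟨c', U', h4, h5, h6⟩ := h1.coef k (Cw k) (z k)
    refine ⟨_, U', h4, ?_, ?_⟩
    · simp only [labs, List.map_cons, h5] at h2 ⊢
      rw [h2]
    · rw [h6, h3]; simp [mul_assoc]

lemma val_cat (A : List ((α × ℕ) × Bool)) (u) (B : List ((α × ℕ) × Bool)) :
    val (A ++ u :: B) = val A * val [u] * val B := by
  rw [val_append, val_cons, mul_assoc]

/-- commutator decomposition of a single quadratic word -/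
lemma Good.comms [DecidableEq α] (N : ℕ) (hN : 0 < N) : ∀ (l : ℕ) (U : List ((α × ℕ) × Bool)),
    U.length ≤ l → U.length ≤ N → ∀ n, Good n ([] : List (K × List ((α × ℕ) × Bool))) U →
    ∃ a b : Fin n → FreeGroup α, (∀ i, (a i).norm < 2 * N ∧ (b i).norm < 2 * N) ∧
      val U = (List.ofFn fun i => (a i)⁻¹ * (b i)⁻¹ * a i * b i).prod := by
  intro l
  induction l with
  | zero =>
    intro U hl _ n _
    have : U = [] := List.length_eq_zero_iff.1 (by omega)
    subst this
    refine ⟨fun _ => 1, fun _ => 1, fun i => by simp [hN], ?_⟩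
    simp
  | succ l ih =>
    intro U hl hlN n h
    by_cases hU : U = []
    · exact ih U (by simp [hU]) hlN n h
    have hq : Quad U := by simpa [tot] using h.1
    rcases hq.exists_pair hU with ⟨A, B, u, rfl⟩ | ⟨A, B, D, E, G, x, y, rfl⟩
    · simp only [List.length_append, List.length_cons] at hl hlN
      obtain ⟨a, b, h1, h2⟩ := ih (A ++ B) (by simp; omega) (by simp; omega) n h.cancel
      refine ⟨a, b, h1, ?_⟩
      rw [← h2, val_append, val_append, val_cons u, val_cons (iv u), val_iv]
      group
    · obtain ⟨n, rfl, h'⟩ := h.handle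
      simp only [List.length_append, List.length_cons] at hl hlN
      obtain ⟨a, b, h1, h2⟩ := ih _ (by simp; omega) (by simp; omega) n h'
      refine ⟨Fin.cons (val (A ++ (E ++ (D ++ (iv x :: rv A))))) a,
        Fin.cons (val (A ++ (E ++ (iv y :: (rv B ++ (rv D ++ (rv E ++ rv A))))))) b, ?_, ?_⟩
      · intro i
        refine Fin.cases ?_ (fun i => ?_) i
        · simp only [Fin.cons_zero]
          constructor
          · refine lt_of_le_of_lt (norm_val_le _) ?_
            simp [rv]; omega
          · refine lt_of_le_of_lt (norm_val_le _) ?_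
            simp [rv]; omega
        · simpa using h1 i
      · rw [List.ofFn_succ]
        simp only [Fin.cons_zero, Fin.cons_succ, List.prod_cons]
        rw [← h2]
        have e1 : val (A ++ x :: (B ++ y :: (D ++ iv x :: (E ++ iv y :: G)))) =
            val A * val [x] * (val B * val [y] * (val D * (val [x])⁻¹ *
              (val E * (val [y])⁻¹ * val G))) := by
          rw [val_cat, val_cat, val_cat, val_cat, val_iv, val_iv]
        have e2 : val (A ++ (E ++ (D ++ (iv x :: rv A)))) =
            val A * (val E * (val D * (val [x])⁻¹ * (val A)⁻¹)) := by
          rw [val_append, val_append, val_cat, val_iv, val_rv]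
        have e3 : val (A ++ (E ++ (iv y :: (rv B ++ (rv D ++ (rv E ++ rv A)))))) =
            val A * (val E * (val [y])⁻¹ * ((val B)⁻¹ * ((val D)⁻¹ *
              ((val E)⁻¹ * (val A)⁻¹)))) := by
          rw [val_append, val_cat, val_append, val_append, val_append, val_iv, val_rv, val_rv,
            val_rv, val_rv]
        have e4 : val (A ++ (E ++ (D ++ (B ++ G)))) =
            val A * (val E * (val D * (val B * val G))) := by
          rw [val_append, val_append, val_append, val_append]
        rw [e1, e2, e3, e4]
        group

/-- letters of a marked word -/
def letters (Λ : List (((α × ℕ) × Bool) ⊕ (K × FreeGroup α))) : List ((α × ℕ) × Bool) :=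
  Λ.filterMap Sum.getLeft?

/-- markers of a marked word -/
def marks (Λ : List (((α × ℕ) × Bool) ⊕ (K × FreeGroup α))) : List K :=
  (Λ.filterMap Sum.getRight?).map Prod.fst

/-- value of a marked word -/
def mval (Λ : List (((α × ℕ) × Bool) ⊕ (K × FreeGroup α))) : FreeGroup α :=
  (Λ.map (Sum.elim (fun u => val [u]) Prod.snd)).prod

@[simp] lemma letters_append (X Y : List (((α × ℕ) × Bool) ⊕ (K × FreeGroup α))) :
    letters (X ++ Y) = letters X ++ letters Y := by simp [letters]
@[simp] lemma marks_append (X Y : List (((α × ℕ) × Bool) ⊕ (K × FreeGroup α))) :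
    marks (X ++ Y) = marks X ++ marks Y := by simp [marks]
@[simp] lemma mval_append (X Y : List (((α × ℕ) × Bool) ⊕ (K × FreeGroup α))) :
    mval (X ++ Y) = mval X * mval Y := by simp [mval]
@[simp] lemma letters_inl (u) (Y : List (((α × ℕ) × Bool) ⊕ (K × FreeGroup α))) :
    letters (Sum.inl u :: Y) = u :: letters Y := by simp [letters]
@[simp] lemma letters_inr (u) (Y : List (((α × ℕ) × Bool) ⊕ (K × FreeGroup α))) :
    letters (Sum.inr u :: Y) = letters Y := rfl
@[simp] lemma marks_inl (u) (Y : List (((α × ℕ) × Bool) ⊕ (K × FreeGroup α))) :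
    marks (Sum.inl u :: Y) = marks Y := rfl
@[simp] lemma marks_inr (u) (Y : List (((α × ℕ) × Bool) ⊕ (K × FreeGroup α))) :
    marks (Sum.inr u :: Y) = u.1 :: marks Y := by simp [marks]
@[simp] lemma mval_inl (u) (Y : List (((α × ℕ) × Bool) ⊕ (K × FreeGroup α))) :
    mval (Sum.inl u :: Y) = val [u] * mval Y := by simp [mval]
@[simp] lemma mval_inr (u) (Y : List (((α × ℕ) × Bool) ⊕ (K × FreeGroup α))) :
    mval (Sum.inr u :: Y) = u.2 * mval Y := by simp [mval]
@[simp] lemma letters_nil : letters ([] : List (((α × ℕ) × Bool) ⊕ (K × FreeGroup α))) = [] := rfl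
@[simp] lemma marks_nil : marks ([] : List (((α × ℕ) × Bool) ⊕ (K × FreeGroup α))) = [] := rfl
@[simp] lemma mval_nil : mval ([] : List (((α × ℕ) × Bool) ⊕ (K × FreeGroup α))) = 1 := rfl
@[simp] lemma letters_map (U : List ((α × ℕ) × Bool)) :
    letters (K := K) (U.map Sum.inl) = U := by
  induction U with
  | nil => rfl
  | cons u U ih => simp [ih]
@[simp] lemma marks_map (U : List ((α × ℕ) × Bool)) :
    marks (K := K) (U.map Sum.inl) = [] := by
  induction U with
  | nil => rfl
  | cons u U ih => simp [ih]
@[simp] lemma mval_map (U : List ((α × ℕ) × Bool)) :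
    mval (K := K) (U.map Sum.inl) = val U := by
  induction U with
  | nil => rfl
  | cons u U ih => simp only [List.map_cons, mval_inl, ih]; rw [← val_cons]

lemma split_letter {Λ : List (((α × ℕ) × Bool) ⊕ (K × FreeGroup α))} {u}
    (h : u ∈ letters Λ) : ∃ X Y, Λ = X ++ Sum.inl u :: Y := by
  have : Sum.inl u ∈ Λ := by
    obtain ⟨t, ht, e⟩ := List.mem_filterMap.1 h
    rcases t with t | t
    · simp only [Sum.getLeft?_inl, Option.some.injEq] at e
      rwa [e] at ht
    · simp at e
  exact List.append_of_mem this

lemma split_mark {Λ : List (((α × ℕ) × Bool) ⊕ (K × FreeGroup α))} {k}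
    (h : k ∈ marks Λ) : ∃ d X Y, Λ = X ++ Sum.inr (k, d) :: Y := by
  obtain ⟨⟨k', d⟩, hm, rfl⟩ := List.mem_map.1 h
  have : Sum.inr (k', d) ∈ Λ := by
    obtain ⟨t, ht, e⟩ := List.mem_filterMap.1 hm
    rcases t with t | t
    · simp at e
    · simp only [Sum.getRight?_inr, Option.some.injEq] at e
      rwa [e] at ht
  exact ⟨d, List.append_of_mem this⟩

/-- admissible markers -/
def MarkOK [DecidableEq α] (Cw : K → FreeGroup α) (k : K) (d : FreeGroup α) : Prop :=
  d.norm ≤ (Cw k).norm ∧ ∃ r : FreeGroup α, r.norm ≤ (Cw k).norm ∧ d⁻¹ = r⁻¹ * Cw k * r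

/-- all markers admissible -/
def AllOK [DecidableEq α] (Cw : K → FreeGroup α)
    (Λ : List (((α × ℕ) × Bool) ⊕ (K × FreeGroup α))) : Prop :=
  ∀ k d, Sum.inr (k, d) ∈ Λ → MarkOK Cw k d

lemma norm_eval_le [DecidableEq α] (Cw : K → FreeGroup α)
    (Λ : List (((α × ℕ) × Bool) ⊕ (K × FreeGroup α))) (h : AllOK Cw Λ) :
    (mval Λ).norm ≤ (letters Λ).length + ((marks Λ).map fun k => (Cw k).norm).sum := by
  induction Λ with
  | nil => simp
  | cons t Λ ih =>
    have ih := ih (fun k d hk => h k d (by simp [hk]))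
    rcases t with u | ⟨k, d⟩
    · rw [mval_inl]
      refine (FreeGroup.norm_mul_le _ _).trans ?_
      have := norm_val_le [u]
      simp only [List.length_singleton] at this
      simp; omega
    · rw [mval_inr]
      refine (FreeGroup.norm_mul_le _ _).trans ?_
      have := (h k d (by simp)).1
      simp; omega

lemma extract [DecidableEq α] [DecidableEq K] (Cw : K → FreeGroup α) (N : ℕ) (I : List K) :
    ∀ (Λ : List (((α × ℕ) × Bool) ⊕ (K × FreeGroup α))), AllOK Cw Λ → (marks Λ).Perm I →
    I.Nodup → (letters Λ).length + ((marks Λ).map fun k => (Cw k).norm).sum ≤ N →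
    ∃ w : K → FreeGroup α, (∀ k, (w k).norm ≤ N) ∧
      (I.map fun k => (w k)⁻¹ * Cw k * w k).prod * mval Λ = val (letters Λ) := by
  induction I using List.reverseRecOn with
  | nil =>
    intro Λ _ hp _ _
    refine ⟨fun _ => 1, by simp, ?_⟩
    have hm : marks Λ = [] := hp.eq_nil
    clear hp
    induction Λ with
    | nil => simp
    | cons t Λ ih =>
      rcases t with u | kd
      · simp only [marks_inl] at hm
        have ih := ih (fun k d hk => by simp_all [AllOK]) (by
          simp_all; omega) hm
        simp only [List.map_nil, List.prod_nil, one_mul, mval_inl, letters_inl] at ih ⊢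
        rw [ih, ← val_cons]
      · simp at hm
  | append_singleton I k ih =>
    intro Λ hok hp hnd hN
    obtain ⟨d, X, Y, rfl⟩ := split_mark (hp.mem_iff.2 (by simp : k ∈ I ++ [k]))
    have hnd' : I.Nodup ∧ k ∉ I := by
      rw [List.nodup_append] at hnd
      refine ⟨hnd.1, fun hk => ?_⟩
      exact hnd.2.2 k hk k (by simp) rfl
    obtain ⟨-, r, hr, hd⟩ := hok k d (by simp)
    have hX : AllOK Cw X := fun k d hk => hok k d (by simp [hk])
    have hbd := norm_eval_le Cw X hX
    simp only [marks_append, marks_inr, letters_append, letters_inr, List.length_append,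
      List.map_append, List.map_cons, List.sum_append, List.sum_cons] at hN hp
    obtain ⟨w, hw, e⟩ := ih (X ++ Y) (fun k d hk => hok k d (by
        simp only [List.mem_append, List.mem_cons] at hk ⊢; tauto)) (by
        rw [marks_append]
        have h1 : (k :: (marks X ++ marks Y)).Perm (k :: I) :=
          (List.perm_middle.symm.trans hp).trans (List.perm_append_singleton k I)
        exact h1.cons_inv) hnd'.1 (by simp; omega)
    refine ⟨Function.update w k (r * (mval X)⁻¹), ?_, ?_⟩
    · intro j
      by_cases hj : j = k
      · subst hj
        rw [Function.update_self]
        refine (FreeGroup.norm_mul_le _ _).trans ?_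
        rw [FreeGroup.norm_inv_eq]
        omega
      · rw [Function.update_of_ne hj]; exact hw j
    · have hI : (I.map fun j => (Function.update w k (r * (mval X)⁻¹) j)⁻¹ * Cw j *
          Function.update w k (r * (mval X)⁻¹) j) = I.map fun j => (w j)⁻¹ * Cw j * w j := by
        refine List.map_congr_left fun j hj => ?_
        have : j ≠ k := fun e => hnd'.2 (e ▸ hj)
        rw [Function.update_of_ne this]
      rw [List.map_append, List.prod_append, hI]
      simp only [List.map_cons, List.map_nil, List.prod_cons, List.prod_nil, mul_one,
        Function.update_self, letters_append, letters_inr] at e ⊢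
      rw [← e]
      have h2 : (r * (mval X)⁻¹)⁻¹ * Cw k * (r * (mval X)⁻¹) = mval X * d⁻¹ * (mval X)⁻¹ := by
        rw [hd]; group
      rw [h2]
      simp only [mval_append, mval_inr]
      group

lemma attach_all [DecidableEq α] (Cw : K → FreeGroup α) (n : ℕ) : ∀ (N : ℕ)
    (cs : List (K × List ((α × ℕ) × Bool))), cs.length = N →
    (∀ c ∈ cs, c.2.map lab = (Cw c.1).toWord) →
    ∀ (Λ : List (((α × ℕ) × Bool) ⊕ (K × FreeGroup α))), AllOK Cw Λ → Good n cs (letters Λ) →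
    ∃ Λ' : List (((α × ℕ) × Bool) ⊕ (K × FreeGroup α)), AllOK Cw Λ' ∧
      Good n ([] : List (K × List ((α × ℕ) × Bool))) (letters Λ') ∧
      mval Λ' = mval Λ ∧ (marks Λ').Perm (marks Λ ++ cs.map Prod.fst) ∧
      (letters Λ').length ≤ (letters Λ).length + (cs.map fun c => (Cw c.1).norm).sum := by
  intro N
  induction N with
  | zero =>
    intro cs hcs _ Λ hok hg
    obtain rfl := List.length_eq_zero_iff.1 hcs
    exact ⟨Λ, hok, hg, rfl, by simp, by simp⟩
  | succ N ih =>
    intro cs hcs hlab Λ hok hg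
    by_cases hex : ∃ u ∈ letters Λ, ∃ c ∈ cs, iv u ∈ c.2
    · obtain ⟨u, hu, ⟨k, c⟩, hc, hu'⟩ := hex
      obtain ⟨X, Y, rfl⟩ := split_letter hu
      obtain ⟨cs₁, cs₂, rfl⟩ := List.append_of_mem hc
      obtain ⟨P, Q, rfl⟩ := List.append_of_mem hu'
      have hl := hlab _ hc
      have hlen := congrArg List.length hl
      change _ = (Cw k).norm at hlen
      simp only [List.length_map, List.length_append, List.length_cons] at hlen
      have hval : val (P ++ iv u :: Q) = Cw k := by
        rw [val]
        change FreeGroup.mk (List.map lab (k, P ++ iv u :: Q).2) = _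
        rw [hl, FreeGroup.mk_toWord]
      rw [val_append, val_cons, val_iv] at hval
      have hdnorm : (val (rv (Q ++ P) ++ [u])).norm ≤ (Cw k).norm := by
        refine (norm_val_le _).trans ?_
        simp [rv]; omega
      have hdval : val (rv (Q ++ P) ++ [u]) = (val P)⁻¹ * (val Q)⁻¹ * val [u] := by
        simp [val_append, val_rv, mul_assoc]
      rw [hdval] at hdnorm
      rw [letters_append, letters_inl] at hg
      have hg' := hg.attach
      obtain ⟨Λ', h1, h2, h3, h4, h5⟩ := ih (cs₁ ++ cs₂)
        (by simp only [List.length_append, List.length_cons] at hcs ⊢; omega)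
        (fun c hc => hlab c (by simp only [List.mem_append, List.mem_cons] at hc ⊢; tauto))
        (X ++ ((Q ++ P).map Sum.inl ++ Sum.inr (k, (val P)⁻¹ * (val Q)⁻¹ * val [u]) :: Y))
        (by
          intro k' d' hk'
          simp only [List.mem_append, List.mem_cons, List.mem_map, reduceCtorEq, and_false,
            exists_false, false_or, Sum.inr.injEq, Prod.mk.injEq] at hk'
          rcases hk' with hk' | ⟨rfl, rfl⟩ | hk'
          · exact hok _ _ (by simp [hk'])
          · refine ⟨hdnorm, val P, (norm_val_le _).trans (by omega), ?_⟩
            rw [← hval]; group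
          · exact hok _ _ (by simp [hk']))
        (by
          rw [letters_append, letters_append, letters_map, letters_inr]
          simpa only [List.append_assoc] using hg')
      refine ⟨Λ', h1, h2, ?_, ?_, ?_⟩
      · rw [h3]
        simp only [mval_append, mval_map, mval_inr, mval_inl, val_append]
        group
      · refine h4.trans ?_
        classical
        rw [List.perm_iff_count]
        intro w
        simp only [marks_append, marks_map, marks_inr, marks_inl, List.map_append, List.map_cons,
          List.count_append, List.count_cons, List.count_nil]
        omega
      · simp only [letters_append, letters_map, letters_inr, letters_inl, List.map_append,
          List.map_cons, List.sum_append, List.sum_cons, List.length_append,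
          List.length_cons] at h5 ⊢
        omega
    · push Not at hex
      obtain ⟨⟨k, c⟩, cs, rfl⟩ := List.exists_cons_of_length_eq_add_one hcs
      have hg' := hg.adjoin hex
      have hl := hlab (k, c) (by simp)
      have hlen := congrArg List.length hl
      change _ = (Cw k).norm at hlen
      simp only [List.length_map] at hlen
      have hval : val c = Cw k := by
        rw [val]
        change FreeGroup.mk (List.map lab (k, c).2) = _
        rw [hl, FreeGroup.mk_toWord]
      obtain ⟨Λ', h1, h2, h3, h4, h5⟩ := ih cs (by simpa using hcs)
        (fun c hc => hlab c (by simp [hc]))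
        (Λ ++ (c.map Sum.inl ++ [Sum.inr (k, (val c)⁻¹)]))
        (by
          intro k' d' hk'
          simp only [List.mem_append, List.mem_cons, List.mem_map, reduceCtorEq, and_false,
            exists_false, false_or, Sum.inr.injEq, Prod.mk.injEq, List.not_mem_nil,
            or_false] at hk'
          rcases hk' with hk' | ⟨rfl, rfl⟩
          · exact hok _ _ hk'
          · refine ⟨by rw [FreeGroup.norm_inv_eq, hval], 1, by simp, ?_⟩
            rw [hval]; group)
        (by simpa using hg')
      refine ⟨Λ', h1, h2, ?_, ?_, ?_⟩
      · rw [h3]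
        simp
      · refine h4.trans ?_
        simp
      · simp only [letters_append, letters_map, letters_inr, letters_nil,
          List.map_cons, List.sum_cons, List.length_append, List.length_nil] at h5 ⊢
        omega

end words
end QE

/-- **Theorem 2 (orientable case), equation form.** If the standard orientable quadratic
equation `(∏ᵢ [xᵢ,yᵢ]) (∏ⱼ zⱼ⁻¹ Cⱼ zⱼ) C = 1` (commutator `[x,y] = x⁻¹ y⁻¹ x y`) with
nontrivial cyclically reduced coefficients has a solution in a free group, then there are
conjugators `wⱼ` with `|wⱼ| ≤ 2s` and elements `aᵢ, bᵢ` with `|aᵢ| < 2s`, `|bᵢ| < 2s`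
such that `(∏ⱼ wⱼ⁻¹ Cⱼ wⱼ) C = [a₁,b₁] ⋯ [a_g,b_g]`, where `s` is the total length of
the coefficients. -/
theorem stmt_13 {α : Type*} [DecidableEq α] (g m : ℕ) (hg : 1 ≤ g) (hm : 1 ≤ m)
    (Cj : Fin (m - 1) → FreeGroup α) (C : FreeGroup α)
    (hCj : ∀ j, Cj j ≠ 1 ∧ CyclicallyReduced (Cj j))
    (hC : C ≠ 1) (hCred : CyclicallyReduced C)
    (s : ℕ) (hs : s = (∑ j, (Cj j).norm) + C.norm)
    (x y : Fin g → FreeGroup α) (z : Fin (m - 1) → FreeGroup α)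
    (hsol : (List.ofFn fun i => (x i)⁻¹ * (y i)⁻¹ * x i * y i).prod *
        (List.ofFn fun j => (z j)⁻¹ * Cj j * z j).prod * C = 1) :
    ∃ w : Fin (m - 1) → FreeGroup α, ∃ a b : Fin g → FreeGroup α,
      (∀ j, (w j).norm ≤ 2 * s) ∧
      (∀ i, (a i).norm < 2 * s ∧ (b i).norm < 2 * s) ∧
      (List.ofFn fun j => (w j)⁻¹ * Cj j * w j).prod * C =
        (List.ofFn fun i => (a i)⁻¹ * (b i)⁻¹ * a i * b i).prod := by
  classical
  have hspos : 0 < s := by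
    have : 0 < C.norm := Nat.pos_of_ne_zero (by simpa using hC)
    omega
  obtain ⟨U₀, hU₀, hv₀⟩ := QE.start_comm (K := Fin (m - 1))
    (List.ofFn fun i => ((y i, x i) : FreeGroup α × FreeGroup α)).reverse
  obtain ⟨cs, U, hU, hlabs, hv⟩ := QE.start_coef Cj z hU₀ (List.finRange (m - 1)).reverse
  rw [List.length_reverse, List.length_ofFn] at hU
  have hP : QE.val U₀ = (List.ofFn fun i => (x i)⁻¹ * (y i)⁻¹ * x i * y i).prod⁻¹ := by
    rw [hv₀, List.prod_inv_reverse, List.map_reverse]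
    congr 2
    simp only [List.map_ofFn]
    congr 1
    funext i
    simp only [Function.comp]
    group
  have hQ : ((List.finRange (m - 1)).reverse.map fun k => (z k)⁻¹ * (Cj k)⁻¹ * z k).prod =
      (List.ofFn fun j => (z j)⁻¹ * Cj j * z j).prod⁻¹ := by
    rw [List.prod_inv_reverse, List.map_reverse, List.ofFn_eq_map, List.map_map]
    congr 3
    funext i
    simp only [Function.comp]
    group
  have hUC : QE.val U = C := by
    rw [hv, hQ, hP, ← mul_inv_rev]
    exact inv_eq_of_mul_eq_one_right hsol
  have hred : FreeGroup.Red (U.map QE.lab) C.toWord := by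
    rw [← hUC, QE.val, FreeGroup.toWord_mk]
    exact FreeGroup.reduce.red
  obtain ⟨cs', U', hg', hU', hlabs'⟩ := QE.Good.red hred cs U rfl hU.good
  rw [hlabs] at hlabs'
  have hfst : cs'.map Prod.fst = (List.finRange (m - 1)).reverse := by
    have := congrArg (List.map Prod.fst) hlabs'
    simpa [QE.labs, Function.comp_def] using this
  have hcs' : ∀ c ∈ cs', c.2.map QE.lab = (Cj c.1).toWord := by
    intro c hc
    have : (c.1, c.2.map QE.lab) ∈ QE.labs cs' := List.mem_map.2 ⟨c, hc, rfl⟩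
    rw [hlabs'] at this
    obtain ⟨k, -, e⟩ := List.mem_map.1 this
    simp only [Prod.mk.injEq] at e
    rw [← e.2, e.1]
  have hsum : (cs'.map fun c => (Cj c.1).norm).sum = ∑ j, (Cj j).norm := by
    have : (cs'.map fun c => (Cj c.1).norm) = (cs'.map Prod.fst).map fun k => (Cj k).norm := by
      simp
    rw [this, hfst, List.map_reverse, List.sum_reverse, ← List.ofFn_eq_map, List.sum_ofFn]
  have hlenU : U'.length = C.norm := by
    have := congrArg List.length hU'
    simpa [FreeGroup.norm] using this
  obtain ⟨Λ, hok, hg, he, hm', hl⟩ := QE.attach_all Cj g _ cs' rfl hcs' (U'.map Sum.inl)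
    (by intro k d hk; simp at hk) (by simpa using hg')
  rw [QE.letters_map, hsum, hlenU] at hl
  rw [QE.marks_map, List.nil_append, hfst] at hm'
  have hm2 : (QE.marks Λ).Perm (List.finRange (m - 1)) := hm'.trans (List.reverse_perm _)
  have hsum2 : ((QE.marks Λ).map fun k => (Cj k).norm).sum = ∑ j, (Cj j).norm := by
    rw [(hm2.map _).sum_eq, ← List.ofFn_eq_map, List.sum_ofFn]
  obtain ⟨w, hw, hprod⟩ := QE.extract Cj (2 * s) (List.finRange (m - 1)) Λ hok hm2
    (List.nodup_finRange _) (by rw [hsum2]; omega)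
  obtain ⟨a, b, hab, hval⟩ := QE.Good.comms s hspos _ (QE.letters Λ) le_rfl (by omega) g hg
  refine ⟨w, a, b, hw, hab, ?_⟩
  rw [← hval, ← hprod, he, QE.mval_map, List.ofFn_eq_map]
  congr 1
  rw [QE.val, hU', FreeGroup.mk_toWord]
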